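/- arXiv:1207.2981 — 11 statements merged into one kernel-verified Lean document; each statement's English description precedes it below -/
import Mathlib

section
/- Let A ∈ ℝ^{n×n}, C ∈ ℝ^{m×n}, L ∈ ℝ^{n×m} be such that (A − LC)^p = 0 for some integer p ≥ 1, let G = [γ_ij] ∈ ℝ^{q×q} be a deadbeat coupling matrix, and let r ≥ 1 be an integer with G^r = G^{r+1}. Then for every Q ∈ ℝ^{m×m} the coupled array x_i(k+1) = A x_i(k) + L(Σ_{j=1}^q γ_ij Q C x_j(k) − C x_i(k)), i = 1,…,q, achieves deadbeat synchronization with horizon rp: for all initial conditions x_1(0),…,x_q(0) ∈ ℝ^n, the solutions satisfy x_i(k) = x_j(k) for all k ≥ rp and all i, j. -/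
open Matrix Kronecker Polynomial

/-- `G ∈ ℝ^{q×q}` is a deadbeat coupling matrix: each row sums to 1 (so `λ = 1`
is an eigenvalue with eigenvector `𝟙`) and all remaining eigenvalues lie at the
origin, i.e. the characteristic polynomial of `G` is `s^{q-1}(s-1)`. -/
def IsDeadbeatCoupling {q : ℕ} (G : Matrix (Fin q) (Fin q) ℝ) : Prop :=
  (∀ i, ∑ j, G i j = 1) ∧ G.charpoly = X ^ (q - 1) * (X - 1)

/-- A fixed vector of a deadbeat coupling matrix is constant. -/
lemma deadbeat_fixed_const {q : ℕ} (G : Matrix (Fin q) (Fin q) ℝ) (hG : IsDeadbeatCoupling G)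
    (v : Fin q → ℝ) (hv : G *ᵥ v = v) (i j : Fin q) : v i = v j := by
  obtain ⟨h1, h2⟩ := hG
  have hfin : Module.finrank ℝ (Module.End.eigenspace (Matrix.toLin' G) (1 : ℝ)) ≤ 1 := by
    refine (LinearMap.finrank_eigenspace_le _ _).trans ?_
    rw [Matrix.charpoly_toLin', h2]
    have hne : (X ^ (q - 1) * (X - 1) : ℝ[X]) ≠ 0 := by
      rw [← h2]; exact G.charpoly_monic.ne_zero
    rw [Polynomial.rootMultiplicity_mul hne]
    have e1 : rootMultiplicity (1 : ℝ) (X ^ (q - 1) : ℝ[X]) = 0 := by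
      apply rootMultiplicity_eq_zero
      simp
    have e2 : rootMultiplicity (1 : ℝ) (X - 1 : ℝ[X]) = 1 := by
      have := rootMultiplicity_X_sub_C_self (x := (1 : ℝ))
      simpa using this
    rw [e1, e2]
  obtain ⟨w, hw⟩ := finrank_le_one_iff.mp hfin
  have hone : (fun _ => 1 : Fin q → ℝ) ∈ Module.End.eigenspace (Matrix.toLin' G) (1 : ℝ) := by
    rw [Module.End.mem_eigenspace_iff]
    ext a
    simp [Matrix.mulVec, dotProduct, h1]
  have hvm : v ∈ Module.End.eigenspace (Matrix.toLin' G) (1 : ℝ) := by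
    rw [Module.End.mem_eigenspace_iff]
    simp [hv]
  obtain ⟨c, hc⟩ := hw ⟨_, hone⟩
  obtain ⟨d, hd⟩ := hw ⟨_, hvm⟩
  have hc' : ∀ a, c * w.1 a = 1 := fun a => congrFun (congrArg Subtype.val hc) a
  have hd' : ∀ a, d * w.1 a = v a := fun a => congrFun (congrArg Subtype.val hd) a
  have hc0 : c ≠ 0 := by
    rintro rfl
    simpa using hc' i
  have : w.1 i = w.1 j := mul_left_cancel₀ hc0 ((hc' i).trans (hc' j).symm)
  rw [← hd', ← hd', this]

/-- Theorem (linear deadbeat synchronization): if `(A - LC)^p = 0`, `G` is a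
deadbeat coupling matrix with `G^r = G^{r+1}`, then for every `Q` the coupled
array `xᵢ⁺ = Axᵢ + L(∑ⱼ γᵢⱼ Q C xⱼ - C xᵢ)` achieves deadbeat synchronization
with horizon `rp`. -/
theorem linear_deadbeat_synchronization {n m q : ℕ}
    (A : Matrix (Fin n) (Fin n) ℝ) (C : Matrix (Fin m) (Fin n) ℝ)
    (L : Matrix (Fin n) (Fin m) ℝ)
    (p : ℕ) (hp : 1 ≤ p) (hALC : (A - L * C) ^ p = 0)
    (G : Matrix (Fin q) (Fin q) ℝ) (hG : IsDeadbeatCoupling G)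
    (r : ℕ) (hr : 1 ≤ r) (hGr : G ^ r = G ^ (r + 1))
    (Q : Matrix (Fin m) (Fin m) ℝ)
    (x : ℕ → Fin q → Fin n → ℝ)
    (hdyn : ∀ k i, x (k + 1) i =
      A *ᵥ x k i + L *ᵥ ((∑ j, G i j • (Q *ᵥ (C *ᵥ x k j))) - C *ᵥ x k i)) :
    ∀ k, r * p ≤ k → ∀ i j, x k i = x k j := by
  set F : Matrix (Fin n) (Fin n) ℝ := (A - L * C)ᵀ with hF
  set H : Matrix (Fin n) (Fin n) ℝ := (L * Q * C)ᵀ with hH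
  have hFp : F ^ p = 0 := by rw [hF, ← Matrix.transpose_pow, hALC, Matrix.transpose_zero]
  let Z : ℕ → Matrix (Fin q) (Fin n) ℝ := fun k => Matrix.of (x k)
  have hZ : ∀ k, Z (k + 1) = Z k * F + G * Z k * H := by
    intro k
    ext i a
    have e1 : (Z k * F) i = (A - L * C) *ᵥ x k i := by
      rw [hF, ← Matrix.vecMul_transpose]; rfl
    have e2 : (G * Z k * H) i = (L * Q * C) *ᵥ (∑ j, G i j • x k j) := by
      have e3 : (G * Z k) i = ∑ j, G i j • x k j := by
        ext b
        simp [Matrix.mul_apply, Z]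
      rw [hH, ← e3, ← Matrix.vecMul_transpose]; rfl
    have : Z (k + 1) i = (Z k * F) i + (G * Z k * H) i := by
      rw [e1, e2]
      change x (k + 1) i = _
      rw [hdyn]
      simp only [Matrix.sub_mulVec, Matrix.mulVec_sub, Matrix.mulVec_sum, Matrix.mulVec_smul,
        Matrix.mulVec_mulVec, Matrix.mul_assoc]
      abel
    exact congrFun this a
  have hGr' : G * G ^ r = G ^ r := by rw [← pow_succ', ← hGr]
  have key : ∀ t s, s + t = r → ∀ k, t * p ≤ k → (G ^ s - G ^ r) * Z k = 0 := by
    intro t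
    induction t with
    | zero =>
      intro s hs k _
      have : s = r := by omega
      rw [this, sub_self, Matrix.zero_mul]
    | succ t ih =>
      intro s hs k hk
      have step : ∀ a, (G ^ s - G ^ r) * Z (t * p + a) = (G ^ s - G ^ r) * Z (t * p) * F ^ a := by
        intro a
        induction a with
        | zero => simp
        | succ a iha =>
          have h0 := ih (s + 1) (by omega) (t * p + a) (by omega)
          have hc : (G ^ s - G ^ r) * G = G ^ (s + 1) - G ^ r := by
            rw [sub_mul, ← pow_succ, ← pow_succ, ← hGr]
          rw [← add_assoc, hZ, Matrix.mul_add, ← Matrix.mul_assoc, iha, ← Matrix.mul_assoc,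
            ← Matrix.mul_assoc, hc, h0, Matrix.zero_mul, add_zero, pow_succ, Matrix.mul_assoc]
      have hk' : t * p + p ≤ k := by rwa [Nat.succ_mul] at hk
      obtain ⟨b, rfl⟩ := Nat.exists_eq_add_of_le hk'
      rw [add_assoc, step, pow_add, hFp, zero_mul, Matrix.mul_zero]
  intro k hk i j
  have h0 := key r 0 (by omega) k hk
  rw [pow_zero, Matrix.sub_mul, Matrix.one_mul, sub_eq_zero] at h0
  have hfix : G * Z k = Z k := by
    rw [h0, ← Matrix.mul_assoc, hGr']
  ext a
  refine deadbeat_fixed_const G hG (fun i => x k i a) ?_ i j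
  ext b
  exact congrFun (congrFun hfix b) a
end

section
/- Let A ∈ ℝ^{n×n} be nonsingular and C ∈ ℝ^{m×n} be such that there exists L ∈ ℝ^{n×m} with (A − LC)^p = 0 for some integer p ≥ 1. Let Q ∈ ℝ^{m×m} be nonsingular and G ∈ ℝ^{q×q} a deadbeat coupling matrix, and consider the deadbeat interconnection γ : (ℝ^m)^q → (ℝ^m)^q given by 𝐲 ↦ (G ⊗ Q)𝐲 (Kronecker product). Then the triple (A, C, G ⊗ Q) is compatible: for every σ ≥ 1 and every 𝐱 ∈ ℝ^{qn}, if (I_q ⊗ C A^k)𝐱 ∈ Y_σ for all k ∈ {0, 1, …, p−1}, then (I_q ⊗ C A^p)𝐱 ∈ Y_σ. -/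
open Matrix Kronecker Polynomial

/-- Membership of `𝐲 ∈ (ℝ^m)^q` (vectorized over `Fin q × Fin m`) in
`Y₀ = {(y₁,…,y_q) : y₁ = ⋯ = y_q}`. -/
def InY0 {q m : ℕ} (y : Fin q × Fin m → ℝ) : Prop :=
  ∀ i i' j, y (i, j) = y (i', j)

theorem iter_eq {ι : Type*} [Fintype ι] [DecidableEq ι] (M : Matrix ι ι ℝ) (s : ℕ) (w : ι → ℝ) :
    (fun w => M *ᵥ w)^[s] w = (M ^ s) *ᵥ w := by
  induction s with
  | zero => simp
  | succ s ih => rw [Function.iterate_succ_apply', ih, pow_succ', Matrix.mulVec_mulVec]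

theorem kron_pow {q m : ℕ} (G : Matrix (Fin q) (Fin q) ℝ) (Q : Matrix (Fin m) (Fin m) ℝ) (s : ℕ) :
    (G ⊗ₖ Q) ^ s = (G ^ s) ⊗ₖ (Q ^ s) := by
  induction s with
  | zero => simp
  | succ s ih => rw [pow_succ, ih, pow_succ, pow_succ, Matrix.mul_kronecker_mul]

theorem kron_mulVec_apply {q m n : ℕ} (P : Matrix (Fin q) (Fin q) ℝ) (N : Matrix (Fin m) (Fin n) ℝ)
    (x : Fin q × Fin n → ℝ) (i : Fin q) (j : Fin m) :
    ((P ⊗ₖ N) *ᵥ x) (i, j) = (N *ᵥ (fun l => ∑ i', P i i' * x (i', l))) j := by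
  simp only [Matrix.mulVec, dotProduct, Fintype.sum_prod_type, Matrix.kroneckerMap_apply,
    Finset.mul_sum]
  rw [Finset.sum_comm]
  refine Finset.sum_congr rfl fun a _ => Finset.sum_congr rfl fun b _ => ?_
  ring

theorem inY0_iff {q m n : ℕ} (G : Matrix (Fin q) (Fin q) ℝ) (Q : Matrix (Fin m) (Fin m) ℝ)
    (hQ : IsUnit Q.det) (s : ℕ) (M : Matrix (Fin m) (Fin n) ℝ) (x : Fin q × Fin n → ℝ) :
    InY0 ((fun w => (G ⊗ₖ Q) *ᵥ w)^[s] (((1 : Matrix (Fin q) (Fin q) ℝ) ⊗ₖ M) *ᵥ x)) ↔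
      ∀ i i', M *ᵥ ((fun l => ∑ a, (G ^ s) i a * x (a, l)) -
        (fun l => ∑ a, (G ^ s) i' a * x (a, l))) = 0 := by
  have hinj : Function.Injective (Q ^ s).mulVec := by
    apply Matrix.mulVec_injective_of_isUnit
    exact ((Matrix.isUnit_iff_isUnit_det Q).2 hQ).pow s
  rw [iter_eq, kron_pow, Matrix.mulVec_mulVec, ← Matrix.mul_kronecker_mul, mul_one]
  unfold InY0
  simp only [kron_mulVec_apply, Matrix.mulVec_sub, sub_eq_zero]
  constructor
  · intro h i i'
    apply hinj
    simp only [Matrix.mulVec_mulVec]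
    exact funext fun j => h i i' j
  · intro h i i' j
    rw [← Matrix.mulVec_mulVec, ← Matrix.mulVec_mulVec, h i i']

theorem obs {n m : ℕ} (A : Matrix (Fin n) (Fin n) ℝ) (C : Matrix (Fin m) (Fin n) ℝ)
    (L : Matrix (Fin n) (Fin m) ℝ) (p : ℕ) (d : Fin n → ℝ)
    (h : ∀ k < p, (C * A ^ k) *ᵥ d = 0) : ∀ k ≤ p, (A - L * C) ^ k *ᵥ d = A ^ k *ᵥ d := by
  intro k
  induction k with
  | zero => simp
  | succ k ih =>
    intro hk
    have h1 := h k (by omega)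
    rw [pow_succ', ← Matrix.mulVec_mulVec, ih (by omega), Matrix.sub_mulVec, pow_succ',
      Matrix.mulVec_mulVec, Matrix.mulVec_mulVec, Matrix.mul_assoc, ← Matrix.mulVec_mulVec _ L, h1]
    simp

/-- Theorem (compatibility in the linear case): with `A` nonsingular,
`(A - LC)^p = 0` for some `L`, `Q` nonsingular and `G` a deadbeat coupling
matrix, the triple `(A, C, G ⊗ Q)` is compatible: for every `σ ≥ 1` and
`𝐱 ∈ ℝ^{qn}`, if `(I_q ⊗ C A^k)𝐱 ∈ Y_σ` for all `k ∈ {0,…,p-1}` then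
`(I_q ⊗ C A^p)𝐱 ∈ Y_σ`, where `Y_σ = {𝐲 : ((G ⊗ Q) *ᵥ ·)^σ 𝐲 ∈ Y₀}`. -/
theorem linear_compatibility {n m q : ℕ}
    (A : Matrix (Fin n) (Fin n) ℝ) (hA : IsUnit A.det)
    (C : Matrix (Fin m) (Fin n) ℝ)
    (p : ℕ) (hp : 1 ≤ p)
    (hL : ∃ L : Matrix (Fin n) (Fin m) ℝ, (A - L * C) ^ p = 0)
    (Q : Matrix (Fin m) (Fin m) ℝ) (hQ : IsUnit Q.det)
    (G : Matrix (Fin q) (Fin q) ℝ) (hG : IsDeadbeatCoupling G)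
    (σ : ℕ) (hσ : 1 ≤ σ) (x : Fin q × Fin n → ℝ)
    (hx : ∀ k < p, InY0 ((fun w => (G ⊗ₖ Q) *ᵥ w)^[σ]
      (((1 : Matrix (Fin q) (Fin q) ℝ) ⊗ₖ (C * A ^ k)) *ᵥ x))) :
    InY0 ((fun w => (G ⊗ₖ Q) *ᵥ w)^[σ]
      (((1 : Matrix (Fin q) (Fin q) ℝ) ⊗ₖ (C * A ^ p)) *ᵥ x)) := by
  obtain ⟨L, hL⟩ := hL
  rw [inY0_iff G Q hQ]
  intro i i'
  have h := obs A C L p _ (fun k hk => (inY0_iff G Q hQ σ _ x).1 (hx k hk) i i') p le_rfl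
  rw [← Matrix.mulVec_mulVec, ← h, hL]
  simp
end

section
/- Suppose f : X → X is bijective, there exists an integer p ≥ 1 such that [x̂]_{p−2}^+ ∩ h⁻¹(y) is a singleton for all x̂ ∈ X and y ∈ Y, γ = (γ_1,…,γ_q) : Y^q → Y^q is a deadbeat interconnection with deadbeat horizon r, and the triple (f, h, γ) is compatible. Then the array x_i(k+1) = f(the unique element of [x_i(k)]_{p−2}^+ ∩ h⁻¹(w_i(k))), where w_i(k) = γ_i(h(x_1(k)),…,h(x_q(k))), i = 1,…,q, achieves deadbeat synchronization with deadbeat horizon τ = rp: for all initial conditions, x_i(k) = x_j(k) for all k ≥ rp and all i, j. -/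
/-- `[x]_k`: `[x]_0 = h⁻¹(h x)`, `[x]_{k+1} = [x]_k⁺ ∩ [x]_0`, where
`[x]_k⁺ = f([f⁻¹(x)]_k)` and `[S]_k = ⋃ z ∈ S, [z]_k`. -/
def obsSet {X Y : Type*} (f : X → X) (h : X → Y) : ℕ → X → Set X
  | 0, x => h ⁻¹' {h x}
  | k + 1, x => (f '' ⋃ z ∈ f ⁻¹' {x}, obsSet f h k z) ∩ h ⁻¹' {h x}

/-- `[x]_k⁺ := f([f⁻¹(x)]_k)`, with `f⁻¹` the set-valued inverse. -/
def obsSetPlus {X Y : Type*} (f : X → X) (h : X → Y) (k : ℕ) (x : X) : Set X :=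
  f '' ⋃ z ∈ f ⁻¹' {x}, obsSet f h k z

/-- `obsSetPlus' f h n x = [x]_{n-1}⁺`, with the convention `[x]_{-1}⁺ = X`
(so `[x]_{p-2}⁺ = obsSetPlus' f h (p-1) x` for `p ≥ 1`). -/
def obsSetPlus' {X Y : Type*} (f : X → X) (h : X → Y) : ℕ → X → Set X
  | 0, _ => Set.univ
  | n + 1, x => obsSetPlus f h n x
/-- Membership in `Y₀`: all components of a `q`-tuple are equal. -/
def IsDiag {Y : Type*} {q : ℕ} (y : Fin q → Y) : Prop := ∀ i j, y i = y j

/-- `γ : Y^q → Y^q` is a deadbeat interconnection with deadbeat horizon `r ≥ 1`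
if `γ(Y₀) ⊆ Y₀` and `γ^r(Y^q) ⊆ Y₀`. -/
def IsDeadbeatInterconnection {Y : Type*} {q : ℕ}
    (γ : (Fin q → Y) → (Fin q → Y)) (r : ℕ) : Prop :=
  1 ≤ r ∧ (∀ y, IsDiag y → IsDiag (γ y)) ∧ ∀ y, IsDiag (γ^[r] y)

/-- The triple `(f, h, γ)` is compatible (with horizon `p`): for every `σ ≥ 1`
and `𝐱 ∈ X^q`, if `h(f^k(𝐱)) ∈ Y_σ` for `k = 0, …, p-1` then `h(f^p(𝐱)) ∈ Y_σ`,
where `Y_σ = {𝐲 : γ^σ(𝐲) ∈ Y₀}`. -/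
def Compatible {X Y : Type*} {q : ℕ} (f : X → X) (h : X → Y)
    (γ : (Fin q → Y) → (Fin q → Y)) (p : ℕ) : Prop :=
  ∀ σ, 1 ≤ σ → ∀ x : Fin q → X,
    (∀ k < p, IsDiag (γ^[σ] fun i => h (f^[k] (x i)))) →
    IsDiag (γ^[σ] fun i => h (f^[p] (x i)))

theorem aux_obsSet {X Y : Type*} (f g : X → X) (h : X → Y) (hgf : ∀ x, g (f x) = x)
    (hfg : ∀ x, f (g x) = x) (k : ℕ) : ∀ x ξ, ξ ∈ obsSet f h k x ↔
      ∀ j ≤ k, h (g^[j] ξ) = h (g^[j] x) := by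
  induction k with
  | zero => intro x ξ; simp [obsSet]
  | succ k ih =>
    intro x ξ
    simp only [obsSet, Set.mem_inter_iff, Set.mem_image, Set.mem_iUnion, Set.mem_preimage,
      Set.mem_singleton_iff, ih]
    constructor
    · rintro ⟨⟨a, ⟨z, hz, ha⟩, rfl⟩, h0⟩ j hj
      subst hz
      cases j with
      | zero => exact h0
      | succ j =>
        simp only [Function.iterate_succ_apply, hgf]
        exact ha j (by omega)
    · intro H
      refine ⟨⟨g ξ, ⟨g x, hfg x, fun j hj => ?_⟩, hfg ξ⟩, H 0 (by omega)⟩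
      exact H (j + 1) (by omega)

theorem aux_obsSetPlus {X Y : Type*} (f g : X → X) (h : X → Y) (hgf : ∀ x, g (f x) = x)
    (hfg : ∀ x, f (g x) = x) (n : ℕ) (x ξ : X) : ξ ∈ obsSetPlus' f h n x ↔
      ∀ j, 1 ≤ j → j ≤ n → h (g^[j] ξ) = h (g^[j] x) := by
  cases n with
  | zero =>
    simp only [obsSetPlus', Set.mem_univ, true_iff]
    intro j h1 h2; omega
  | succ n =>
    simp only [obsSetPlus', obsSetPlus, Set.mem_image, Set.mem_iUnion, Set.mem_preimage,
      Set.mem_singleton_iff, aux_obsSet f g h hgf hfg]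
    constructor
    · rintro ⟨a, ⟨z, hz, ha⟩, rfl⟩ j h1 hj
      subst hz
      obtain ⟨j, rfl⟩ : ∃ m, j = m + 1 := ⟨j - 1, by omega⟩
      simp only [Function.iterate_succ_apply, hgf]
      exact ha j (by omega)
    · intro H
      refine ⟨g ξ, ⟨g x, hfg x, fun j hj => ?_⟩, hfg ξ⟩
      exact H (j + 1) (by omega) (by omega)

/-- Main theorem: an array of deadbeat observers coupled through a compatible
deadbeat interconnection achieves deadbeat synchronization with horizon `rp`.
(Here `Y = h(X)`, i.e. `h` is surjective onto the output space.) -/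
theorem deadbeat_synchronization {X Y : Type*} {q : ℕ} (f : X → X) (h : X → Y)
    (hf : Function.Bijective f) (hh : Function.Surjective h)
    (p : ℕ) (hp : 1 ≤ p)
    (hsing : ∀ (xh : X) (y : Y), ∃ z, obsSetPlus' f h (p - 1) xh ∩ h ⁻¹' {y} = {z})
    (γ : (Fin q → Y) → (Fin q → Y)) (r : ℕ)
    (hγ : IsDeadbeatInterconnection γ r)
    (hcomp : Compatible f h γ p)
    (x : ℕ → Fin q → X)
    (hdyn : ∀ k i, x (k + 1) i ∈
      f '' (obsSetPlus' f h (p - 1) (x k i) ∩ h ⁻¹' {γ (fun j => h (x k j)) i})) :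
    ∀ k, r * p ≤ k → ∀ i j, x k i = x k j := by
  obtain ⟨g, hgf, hfg⟩ := Function.bijective_iff_has_inverse.mp hf
  obtain ⟨hr, -, hγr⟩ := hγ
  have inj : ∀ a b : X, (∀ j < p, h (g^[j] a) = h (g^[j] b)) → a = b := by
    intro a b H
    obtain ⟨z, hz⟩ := hsing b (h b)
    have ha : a ∈ ({z} : Set X) := by
      rw [← hz]
      refine ⟨(aux_obsSetPlus f g h hgf hfg _ _ _).2 fun j h1 h2 => H j (by omega), ?_⟩
      exact H 0 (by omega)
    have hb : b ∈ ({z} : Set X) := by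
      rw [← hz]
      exact ⟨(aux_obsSetPlus f g h hgf hfg _ _ _).2 fun j h1 h2 => rfl, rfl⟩
    rw [Set.mem_singleton_iff] at ha hb
    rw [ha, hb]
  -- past outputs of the current state
  have past : ∀ j, 1 ≤ j → j ≤ p → ∀ k i,
      h (g^[j] (x (k + j) i)) = γ (fun l => h (x k l)) i := by
    intro j hj
    induction j, hj using Nat.le_induction with
    | base =>
      intro _ k i
      obtain ⟨z, ⟨-, hz⟩, hx⟩ := hdyn k i
      rw [← hx]
      simpa [hgf z] using hz
    | succ j hj ih =>
      intro hjp k i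
      obtain ⟨z, ⟨hz, -⟩, hx⟩ := hdyn (k + j) i
      have h1 := (aux_obsSetPlus f g h hgf hfg _ _ _).1 hz j hj (by omega)
      rw [← add_assoc, ← hx, Function.iterate_succ_apply, hgf z, h1]
      exact ih (by omega) k i
  have gf_iter : ∀ m n (a : X), f^[m] (g^[m + n] a) = g^[n] a := by
    intro m n a
    rw [Function.iterate_add_apply]
    exact (Function.LeftInverse.iterate hfg m) _
  have key : ∀ s, s < r → ∀ k, s * p ≤ k → IsDiag (γ^[r - s] fun i => h (x k i)) := by
    intro s
    induction s with
    | zero => intro _ k _; exact hγr _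
    | succ s ih =>
      intro hs k hk
      rw [Nat.succ_mul] at hk
      have hc := hcomp (r - (s + 1)) (by omega) (fun i => g^[p] (x k i)) ?_
      · have e : ∀ i, f^[p] (g^[p] (x k i)) = x k i := fun i => gf_iter p 0 _
        simpa only [e] using hc
      · intro m hm
        have e : (fun i => h (f^[m] (g^[p] (x k i)))) =
            γ (fun l => h (x (k - (p - m)) l)) := by
          funext i
          have e1 := gf_iter m (p - m) (x k i)
          rw [show m + (p - m) = p by omega] at e1
          rw [e1, ← past (p - m) (by omega) (by omega),
            show k - (p - m) + (p - m) = k by omega]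
        rw [e, ← Function.iterate_succ_apply, show (r - (s + 1)).succ = r - s by omega]
        exact ih (by omega) _ (by omega)
  intro k hk i j
  obtain ⟨s, rfl⟩ : ∃ s, r = s + 1 := ⟨r - 1, by omega⟩
  rw [Nat.succ_mul] at hk
  have hg : g (x k i) = g (x k j) := by
    apply inj
    intro m hm
    have e : ∀ i, h (g^[m] (g (x k i))) = γ (fun l => h (x (k - (m + 1)) l)) i := by
      intro i
      rw [← past (m + 1) (by omega) (by omega), show k - (m + 1) + (m + 1) = k by omega,
        Function.iterate_succ_apply]
    rw [e, e]
    have := key s (by omega) (k - (m + 1)) (by omega)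
    rw [show s + 1 - s = 1 by omega] at this
    exact this i j
  rw [← hfg (x k i), hg, hfg]
end

section
/- Suppose f : X → X is bijective and there exists an integer p ≥ 1 such that [x̂]_{p−2}^+ ∩ h⁻¹(y) is a singleton for all x̂ ∈ X and y ∈ Y. Then the system x̂(k+1) = f(the unique element of [x̂(k)]_{p−2}^+ ∩ h⁻¹(h(x(k)))) is a deadbeat observer for x(k+1) = f(x(k)) with deadbeat horizon p: for all initial conditions x(0), x̂(0) ∈ X, the solutions satisfy x̂(k) = x(k) for all k ≥ p. -/
theorem aux_plus {X Y : Type*} (e : X ≃ X) (h : X → Y) (k : ℕ) (w x : X) :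
    (w ∈ e '' ⋃ z ∈ e ⁻¹' {x}, obsSet e h k z) ↔ e.symm w ∈ obsSet e h k (e.symm x) := by
  constructor
  · rintro ⟨v, hv, rfl⟩
    simp only [Set.mem_iUnion, Set.mem_preimage, Set.mem_singleton_iff] at hv
    obtain ⟨z, rfl, hz⟩ := hv
    simpa using hz
  · intro hw
    refine ⟨e.symm w, ?_, by simp⟩
    simp only [Set.mem_iUnion, Set.mem_preimage, Set.mem_singleton_iff]
    exact ⟨e.symm x, by simp, hw⟩

theorem aux_obs {X Y : Type*} (e : X ≃ X) (h : X → Y) (k : ℕ) : ∀ w x : X,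
    w ∈ obsSet e h k x ↔ ∀ i ≤ k, h (e.symm^[i] w) = h (e.symm^[i] x) := by
  induction k with
  | zero => intro w x; simp [obsSet]
  | succ k ih =>
    intro w x
    rw [obsSet, Set.mem_inter_iff, aux_plus, ih]
    constructor
    · rintro ⟨h1, h2⟩ i hi
      cases i with
      | zero => simpa using h2
      | succ i => exact h1 i (by omega)
    · intro H
      exact ⟨fun i hi => H (i + 1) (by omega), H 0 (by omega)⟩

theorem aux_plus' {X Y : Type*} (e : X ≃ X) (h : X → Y) (n : ℕ) (w x : X) :
    w ∈ obsSetPlus' e h n x ↔ ∀ i < n, h (e.symm^[i + 1] w) = h (e.symm^[i + 1] x) := by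
  cases n with
  | zero => simp [obsSetPlus']
  | succ n =>
    rw [obsSetPlus', obsSetPlus, aux_plus, aux_obs]
    simp only [Function.iterate_succ_apply, Nat.lt_succ_iff]

/-- Theorem 1 (deadbeat observer): under bijectivity of `f` and the singleton
condition, the system `xh⁺ = f([xh]_{p-2}⁺ ∩ h⁻¹(y))` is a deadbeat observer for
`x⁺ = f(x)` with deadbeat horizon `p`. -/
theorem deadbeat_observer {X Y : Type*} (f : X → X) (h : X → Y)
    (hf : Function.Bijective f) (p : ℕ) (hp : 1 ≤ p)
    (hsing : ∀ xh : X, ∀ y ∈ Set.range h,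
      ∃ z, obsSetPlus' f h (p - 1) xh ∩ h ⁻¹' {y} = {z})
    (x xh : ℕ → X)
    (hx : ∀ k, x (k + 1) = f (x k))
    (hxh : ∀ k, xh (k + 1) ∈ f '' (obsSetPlus' f h (p - 1) (xh k) ∩ h ⁻¹' {h (x k)})) :
    ∀ k, p ≤ k → xh k = x k := by
  obtain ⟨n, rfl⟩ : ∃ n, p = n + 1 := ⟨p - 1, by omega⟩
  obtain ⟨e, rfl⟩ : ∃ e : X ≃ X, (e : X → X) = f := ⟨Equiv.ofBijective f hf, rfl⟩
  simp only [Nat.add_sub_cancel] at hsing hxh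
  have hx' : ∀ k, e.symm (x (k + 1)) = x k := fun k => by simp [hx]
  -- past outputs of the observer agree with those of the system
  have key : ∀ k i, i < k → i ≤ n → h (e.symm^[i + 1] (xh k)) = h (e.symm^[i + 1] (x k)) := by
    intro k
    induction k with
    | zero => intro i hi; omega
    | succ k ih =>
      intro i hi hin
      obtain ⟨w, ⟨hw1, hw2⟩, hw⟩ := hxh k
      rw [aux_plus'] at hw1
      rw [Function.iterate_succ_apply, Function.iterate_succ_apply, hx', ← hw,
        Equiv.symm_apply_apply]
      cases i with
      | zero => exact hw2
      | succ i => exact (hw1 i (by omega)).trans (ih i (by omega) (by omega))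
  intro k hk
  obtain ⟨m, rfl⟩ : ∃ m, k = m + 1 := ⟨k - 1, by omega⟩
  have agree : ∀ i ≤ n, h (e.symm^[i] (e.symm (xh (m + 1)))) = h (e.symm^[i] (x m)) := by
    intro i hi
    have := key (m + 1) i (by omega) hi
    rwa [Function.iterate_succ_apply, Function.iterate_succ_apply, hx'] at this
  obtain ⟨z, hz⟩ := hsing (x m) (h (x m)) ⟨_, rfl⟩
  have h1 : x m ∈ ({z} : Set X) := by
    rw [← hz]
    exact ⟨(aux_plus' e h n _ _).2 fun _ _ => rfl, rfl⟩
  have h2 : e.symm (xh (m + 1)) ∈ ({z} : Set X) := by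
    rw [← hz]
    exact ⟨(aux_plus' e h n _ _).2 fun i hi => agree (i + 1) (by omega), agree 0 (by omega)⟩
  have h3 : e.symm (xh (m + 1)) = x m := h2.trans h1.symm
  rw [hx, ← h3, Equiv.apply_symm_apply]
end

section
/- Suppose f : X → X is bijective. Then for every k ∈ ℕ and every x, z ∈ X, if z ∈ [x]_k then [z]_k = [x]_k. -/
theorem obsSet_eq_of_mem {X Y : Type*} (f : X → X) (h : X → Y)
    (hf : Function.Bijective f) :
    ∀ (k : ℕ) (x z : X), z ∈ obsSet f h k x → obsSet f h k z = obsSet f h k x := by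
  intro k
  induction k with
  | zero =>
    intro x z hz
    simp only [obsSet, Set.mem_preimage, Set.mem_singleton_iff] at hz ⊢
    rw [hz]
  | succ k ih =>
    have key : ∀ w, (⋃ v ∈ f ⁻¹' {f w}, obsSet f h k v) = obsSet f h k w := by
      intro w
      ext u
      simp [hf.1.eq_iff]
    intro x z hz
    obtain ⟨a, rfl⟩ := hf.2 x
    obtain ⟨b, rfl⟩ := hf.2 z
    simp only [obsSet, key] at hz ⊢
    obtain ⟨⟨c, hc, hcb⟩, hh⟩ := hz
    obtain rfl := hf.1 hcb
    rw [ih a c hc, show h (f c) = h (f a) from hh]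
end

section
/- Suppose f : X → X is bijective. Then for every x ∈ X and all k, α ∈ ℕ, [[x]_{k+α}]_k = [x]_k and [[x]_{k+α}^+]_k^+ = [x]_k^+. -/
theorem mem_obsSet_aux {X Y : Type*} (e : X ≃ X) (h : X → Y) (k : ℕ) : ∀ (x y : X),
    y ∈ obsSet e h k x ↔ ∀ i ≤ k, h (e.symm^[i] y) = h (e.symm^[i] x) := by
  induction k with
  | zero => intro x y; simp [obsSet]
  | succ k ih =>
    intro x y
    have key : y ∈ obsSet e h (k + 1) x ↔
        e.symm y ∈ obsSet e h k (e.symm x) ∧ h y = h x := by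
      rw [obsSet]
      constructor
      · rintro ⟨⟨w, hw, rfl⟩, h2⟩
        simp only [Set.mem_iUnion] at hw
        obtain ⟨z, hz, hw⟩ := hw
        have hz' : e z = x := hz
        subst hz'
        exact ⟨by simpa using hw, h2⟩
      · rintro ⟨h1, h2⟩
        refine ⟨⟨e.symm y, ?_, by simp⟩, h2⟩
        simp only [Set.mem_iUnion]
        exact ⟨e.symm x, by simp, h1⟩
    rw [key, ih]
    constructor
    · rintro ⟨h1, h2⟩ i hi
      cases i with
      | zero => exact h2
      | succ i => exact h1 i (by omega)
    · intro H
      exact ⟨fun i hi => H (i + 1) (by omega), H 0 (by omega)⟩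

theorem mem_obsSetPlus_aux {X Y : Type*} (e : X ≃ X) (h : X → Y) (k : ℕ) (x y : X) :
    y ∈ obsSetPlus e h k x ↔ e.symm y ∈ obsSet e h k (e.symm x) := by
  rw [obsSetPlus]
  constructor
  · rintro ⟨w, hw, rfl⟩
    simp only [Set.mem_iUnion] at hw
    obtain ⟨z, hz, hw⟩ := hw
    have hz' : e z = x := hz
    subst hz'
    simpa using hw
  · intro h1
    refine ⟨e.symm y, ?_, by simp⟩
    simp only [Set.mem_iUnion]
    exact ⟨e.symm x, by simp, h1⟩

theorem obsSet_idem {X Y : Type*} (f : X → X) (h : X → Y)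
    (hf : Function.Bijective f) :
    ∀ (x : X) (k α : ℕ),
      (⋃ z ∈ obsSet f h (k + α) x, obsSet f h k z) = obsSet f h k x ∧
      (⋃ z ∈ obsSetPlus f h (k + α) x, obsSetPlus f h k z) = obsSetPlus f h k x := by
  obtain ⟨e, rfl⟩ : ∃ e : X ≃ X, (e : X → X) = f := ⟨Equiv.ofBijective f hf, rfl⟩
  intro x k α
  constructor
  · ext y
    simp only [Set.mem_iUnion, mem_obsSet_aux, exists_prop]
    constructor
    · rintro ⟨z, hz, hy⟩ i hi
      exact (hy i hi).trans (hz i (by omega))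
    · intro H
      exact ⟨x, fun _ _ => rfl, H⟩
  · ext y
    simp only [Set.mem_iUnion, mem_obsSetPlus_aux, mem_obsSet_aux, exists_prop]
    constructor
    · rintro ⟨z, hz, hy⟩ i hi
      exact (hy i hi).trans (hz i (by omega))
    · intro H
      exact ⟨x, fun _ _ => rfl, H⟩
end

section
/- Suppose f : X → X is bijective, there exists an integer p ≥ 1 such that [x̂]_{p−2}^+ ∩ h⁻¹(y) is a singleton for all x̂ ∈ X and y ∈ Y, and γ : Y^q → Y^q is a deadbeat interconnection. Consider the system on X^q given by 𝐱(k+1) = f([𝐱(k)]_{p−2}^+ ∩ h⁻¹(γ(h(𝐱(k))))), applied componentwise (each component's update is the unique element of the corresponding singleton). Then for all k ≥ p−1, the solution 𝐱_k := 𝐱(k) satisfies 𝐱_k ∈ f^{α−1}([𝐱_{k−α+1}]_{p−α}^+) for every α ∈ {1, 2, …, p}. -/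
theorem mem_obsSetPlus_iff {X Y : Type*} (f g : X → X) (h : X → Y)
    (hgf : ∀ a, g (f a) = a) (hfg : ∀ a, f (g a) = a) (k : ℕ) (x w : X) :
    w ∈ obsSetPlus f h k x ↔ g w ∈ obsSet f h k (g x) := by
  unfold obsSetPlus
  constructor
  · rintro ⟨v, hv, rfl⟩
    simp only [Set.mem_iUnion, Set.mem_preimage, Set.mem_singleton_iff] at hv
    obtain ⟨z, rfl, hz⟩ := hv
    rwa [hgf, hgf]
  · intro hw
    refine ⟨g w, ?_, hfg w⟩
    simp only [Set.mem_iUnion, Set.mem_preimage, Set.mem_singleton_iff]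
    exact ⟨g x, hfg x, hw⟩

theorem mem_obsSet_iff {X Y : Type*} (f g : X → X) (h : X → Y)
    (hgf : ∀ a, g (f a) = a) (hfg : ∀ a, f (g a) = a) (k : ℕ) : ∀ (x w : X),
    w ∈ obsSet f h k x ↔ ∀ j ≤ k, h (g^[j] w) = h (g^[j] x) := by
  induction k with
  | zero => intro x w; simp [obsSet]
  | succ k ih =>
    intro x w
    have h1 : w ∈ obsSet f h (k + 1) x ↔ w ∈ obsSetPlus f h k x ∧ h w = h x := Iff.rfl
    rw [h1, mem_obsSetPlus_iff f g h hgf hfg, ih]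
    constructor
    · rintro ⟨ha, hb⟩ j hj
      cases j with
      | zero => exact hb
      | succ j => exact ha j (by omega)
    · intro ha
      exact ⟨fun j hj => ha (j + 1) (by omega), ha 0 (by omega)⟩

/-- Lemma 2: for all `k ≥ p-1` the solution of the coupled array satisfies
`𝐱_k ∈ f^{α-1}([𝐱_{k-α+1}]_{p-α}⁺)` for every `α ∈ {1, …, p}`. -/
theorem lemma_one {X Y : Type*} {q : ℕ} (f : X → X) (h : X → Y)
    (hf : Function.Bijective f) (hh : Function.Surjective h)
    (p : ℕ) (hp : 1 ≤ p)
    (hsing : ∀ (xh : X) (y : Y), ∃ z, obsSetPlus' f h (p - 1) xh ∩ h ⁻¹' {y} = {z})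
    (γ : (Fin q → Y) → (Fin q → Y)) (r : ℕ)
    (hγ : IsDeadbeatInterconnection γ r)
    (x : ℕ → Fin q → X)
    (hdyn : ∀ k i, x (k + 1) i ∈
      f '' (obsSetPlus' f h (p - 1) (x k i) ∩ h ⁻¹' {γ (fun j => h (x k j)) i})) :
    ∀ k, p - 1 ≤ k → ∀ α, 1 ≤ α → α ≤ p → ∀ i,
      x k i ∈ f^[α - 1] '' obsSetPlus f h (p - α) (x (k + 1 - α) i) := by
  obtain ⟨g, hgf, hfg⟩ := Function.bijective_iff_has_inverse.mp hf
  have step : ∀ k i j, j + 1 < p → h (g^[j + 1] (g (x (k + 1) i))) = h (g^[j + 1] (x k i)) := by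
    intro k i j hj
    obtain ⟨v, ⟨hv, -⟩, hx⟩ := hdyn k i
    rw [← hx, hgf]
    obtain ⟨m, rfl⟩ : ∃ m, p = m + 2 := ⟨p - 2, by omega⟩
    have hv' : v ∈ obsSetPlus f h m (x k i) := hv
    rw [mem_obsSetPlus_iff f g h hgf hfg, mem_obsSet_iff f g h hgf hfg] at hv'
    exact hv' j (by omega)
  have key : ∀ n k i j, n ≤ k → n + j < p →
      h (g^[n + j + 1] (x k i)) = h (g^[j + 1] (x (k - n) i)) := by
    intro n
    induction n with
    | zero => intro k i j _ _; simp
    | succ n ih =>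
      intro k i j hk hj
      obtain ⟨k, rfl⟩ : ∃ k', k = k' + 1 := ⟨k - 1, by omega⟩
      have e1 : k + 1 - (n + 1) = k - n := by omega
      have e2 : n + 1 + j + 1 = (n + j + 1) + 1 := by omega
      rw [e1, e2, Function.iterate_succ_apply, step k i (n + j) (by omega)]
      exact ih k i j (by omega) (by omega)
  intro k hk α h1 h2 i
  obtain ⟨n, rfl⟩ : ∃ n, α = n + 1 := ⟨α - 1, by omega⟩
  have e1 : k + 1 - (n + 1) = k - n := by omega
  rw [e1, Nat.add_sub_cancel]
  refine ⟨g^[n] (x k i), ?_, Function.RightInverse.iterate hfg n (x k i)⟩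
  rw [mem_obsSetPlus_iff f g h hgf hfg, mem_obsSet_iff f g h hgf hfg]
  intro j hj
  have := key n k i j (by omega) (by omega)
  rw [← Function.iterate_succ_apply, ← Function.iterate_succ_apply,
    ← Function.iterate_add_apply]
  rw [← this]
  congr 2
  omega
end

section
/- Suppose f : X → X is bijective, there exists an integer p ≥ 1 such that [x̂]_{p−2}^+ ∩ h⁻¹(y) is a singleton for all x̂ ∈ X and y ∈ Y, and γ : Y^q → Y^q is a deadbeat interconnection. Consider the system on X^q given by 𝐱(k+1) = f([𝐱(k)]_{p−2}^+ ∩ h⁻¹(γ(h(𝐱(k))))), applied componentwise. Then for all k ≥ p, the solution 𝐱_k := 𝐱(k) satisfies h(f^{−α}(𝐱_k)) = γ(h(𝐱_{k−α})) for every α ∈ {1, 2, …, p}. -/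
theorem obsSet_out {X Y : Type*} [Nonempty X] (f : X → X) (h : X → Y)
    (hf : Function.Injective f) : ∀ (n : ℕ) (z w : X), w ∈ obsSet f h n z →
    ∀ a, a ≤ n → h ((Function.invFun f)^[a] w) = h ((Function.invFun f)^[a] z) := by
  have hg : ∀ u, Function.invFun f (f u) = u := Function.leftInverse_invFun hf
  intro n
  induction n with
  | zero =>
    intro z w hw a ha
    obtain rfl : a = 0 := by omega
    simpa [obsSet] using hw
  | succ n ih =>
    intro z w hw a ha
    obtain ⟨⟨v, hv, rfl⟩, hw2⟩ := hw
    simp only [Set.mem_iUnion] at hv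
    obtain ⟨u, hu, hv⟩ := hv
    have hu' : f u = z := hu
    subst hu'
    cases a with
    | zero => simpa using hw2
    | succ a =>
      rw [Function.iterate_succ_apply, Function.iterate_succ_apply, hg, hg]
      exact ih u v hv a (by omega)

theorem obsSetPlus'_out {X Y : Type*} [Nonempty X] (f : X → X) (h : X → Y)
    (hf : Function.Injective f) (n : ℕ) (z w : X) (hw : w ∈ obsSetPlus' f h n z)
    (a : ℕ) (h1 : 1 ≤ a) (ha : a ≤ n) :
    h ((Function.invFun f)^[a] w) = h ((Function.invFun f)^[a] z) := by
  have hg : ∀ u, Function.invFun f (f u) = u := Function.leftInverse_invFun hf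
  cases n with
  | zero => omega
  | succ n =>
    obtain ⟨v, hv, rfl⟩ := hw
    simp only [Set.mem_iUnion] at hv
    obtain ⟨u, hu, hv⟩ := hv
    have hu' : f u = z := hu
    subst hu'
    cases a with
    | zero => omega
    | succ a =>
      rw [Function.iterate_succ_apply, Function.iterate_succ_apply, hg, hg]
      exact obsSet_out f h hf n u v hv a (by omega)

/-- Lemma 3: for all `k ≥ p` the solution of the coupled array satisfies
`h(f^{-α}(𝐱_k)) = γ(h(𝐱_{k-α}))` for every `α ∈ {1, …, p}`. -/
theorem lemma_two {X Y : Type*} [Nonempty X] {q : ℕ} (f : X → X) (h : X → Y)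
    (hf : Function.Bijective f) (hh : Function.Surjective h)
    (p : ℕ) (hp : 1 ≤ p)
    (hsing : ∀ (xh : X) (y : Y), ∃ z, obsSetPlus' f h (p - 1) xh ∩ h ⁻¹' {y} = {z})
    (γ : (Fin q → Y) → (Fin q → Y)) (r : ℕ)
    (hγ : IsDeadbeatInterconnection γ r)
    (x : ℕ → Fin q → X)
    (hdyn : ∀ k i, x (k + 1) i ∈
      f '' (obsSetPlus' f h (p - 1) (x k i) ∩ h ⁻¹' {γ (fun j => h (x k j)) i})) :
    ∀ k, p ≤ k → ∀ α, 1 ≤ α → α ≤ p → ∀ i,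
      h ((Function.invFun f)^[α] (x k i)) = γ (fun j => h (x (k - α) j)) i := by
  have hg : ∀ u, Function.invFun f (f u) = u := Function.leftInverse_invFun hf.1
  have key : ∀ α, 1 ≤ α → α ≤ p → ∀ k, α ≤ k → ∀ i,
      h ((Function.invFun f)^[α] (x k i)) = γ (fun j => h (x (k - α) j)) i := by
    intro α h1
    induction α, h1 using Nat.le_induction with
    | base =>
      intro _ k hk i
      obtain ⟨m, rfl⟩ : ∃ m, k = m + 1 := ⟨k - 1, by omega⟩
      obtain ⟨w, ⟨_, hw⟩, e⟩ := hdyn m i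
      rw [← e, Function.iterate_one, hg]
      exact hw
    | succ a h1 ih =>
      intro hap k hk i
      obtain ⟨m, rfl⟩ : ∃ m, k = m + 1 := ⟨k - 1, by omega⟩
      obtain ⟨w, ⟨hw, _⟩, e⟩ := hdyn m i
      rw [← e, Function.iterate_succ_apply, hg,
        obsSetPlus'_out f h hf.1 (p - 1) _ _ hw a h1 (by omega),
        ih (by omega) m (by omega) i, Nat.add_sub_add_right]
  intro k hk α h1 h2 i
  exact key α h1 h2 k (by omega) i
end

section
/- Suppose f : X → X is bijective, there exists an integer p ≥ 1 such that [x̂]_{p−2}^+ ∩ h⁻¹(y) is a singleton for all x̂ ∈ X and y ∈ Y, γ : Y^q → Y^q is a deadbeat interconnection, and the triple (f, h, γ) is compatible. Consider the system on X^q given by 𝐱(k+1) = f([𝐱(k)]_{p−2}^+ ∩ h⁻¹(γ(h(𝐱(k))))), applied componentwise. Then for every k ≥ p and every σ ≥ 1: if h(𝐱(k−α)) ∈ Y_σ for all α ∈ {1, 2, …, p}, then h(𝐱(k)) ∈ Y_{σ−1}. -/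
theorem mem_image_aux {X Y : Type*} (f g : X → X) (h : X → Y)
    (hl : Function.LeftInverse g f) (hr : Function.RightInverse g f) (n : ℕ) (z x : X) :
    (z ∈ f '' ⋃ w ∈ f ⁻¹' {x}, obsSet f h n w) ↔ g z ∈ obsSet f h n (g x) := by
  constructor
  · rintro ⟨u, hu, rfl⟩
    simp only [Set.mem_iUnion, Set.mem_preimage, Set.mem_singleton_iff] at hu
    obtain ⟨w, rfl, hw⟩ := hu
    rwa [hl, hl]
  · intro H
    refine ⟨g z, ?_, hr z⟩
    simp only [Set.mem_iUnion, Set.mem_preimage, Set.mem_singleton_iff]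
    exact ⟨g x, hr x, H⟩

theorem mem_obsSet_aux_s10 {X Y : Type*} (f g : X → X) (h : X → Y)
    (hl : Function.LeftInverse g f) (hr : Function.RightInverse g f) (n : ℕ) :
    ∀ z x : X, z ∈ obsSet f h n x ↔ ∀ j ≤ n, h (g^[j] z) = h (g^[j] x) := by
  induction n with
  | zero => intro z x; simp [obsSet]
  | succ n ih =>
    intro z x
    rw [obsSet, Set.mem_inter_iff, mem_image_aux f g h hl hr, ih]
    constructor
    · rintro ⟨h1, h2⟩ j hj
      cases j with
      | zero => exact h2
      | succ j => exact h1 j (by omega)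
    · intro H
      exact ⟨fun j hj => H (j + 1) (by omega), H 0 (by omega)⟩

theorem mem_plus_aux {X Y : Type*} (f g : X → X) (h : X → Y)
    (hl : Function.LeftInverse g f) (hr : Function.RightInverse g f) (n : ℕ) (z x : X) :
    z ∈ obsSetPlus' f h n x ↔ ∀ j < n, h (g^[j + 1] z) = h (g^[j + 1] x) := by
  cases n with
  | zero => simp [obsSetPlus']
  | succ n =>
    rw [obsSetPlus', obsSetPlus, mem_image_aux f g h hl hr, mem_obsSet_aux_s10 f g h hl hr]
    simp only [Nat.lt_succ_iff, Function.iterate_succ_apply]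

/-- For every `k ≥ p` and `σ ≥ 1`: if `h(𝐱(k-α)) ∈ Y_σ` for all `α ∈ {1, …, p}`,
then `h(𝐱(k)) ∈ Y_{σ-1}`. -/
theorem step_down {X Y : Type*} {q : ℕ} (f : X → X) (h : X → Y)
    (hf : Function.Bijective f) (hh : Function.Surjective h)
    (p : ℕ) (hp : 1 ≤ p)
    (hsing : ∀ (xh : X) (y : Y), ∃ z, obsSetPlus' f h (p - 1) xh ∩ h ⁻¹' {y} = {z})
    (γ : (Fin q → Y) → (Fin q → Y)) (r : ℕ)
    (hγ : IsDeadbeatInterconnection γ r)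
    (hcomp : Compatible f h γ p)
    (x : ℕ → Fin q → X)
    (hdyn : ∀ k i, x (k + 1) i ∈
      f '' (obsSetPlus' f h (p - 1) (x k i) ∩ h ⁻¹' {γ (fun j => h (x k j)) i})) :
    ∀ k, p ≤ k → ∀ σ, 1 ≤ σ →
      (∀ α, 1 ≤ α → α ≤ p → IsDiag (γ^[σ] fun i => h (x (k - α) i))) →
      IsDiag (γ^[σ - 1] fun i => h (x k i)) := by
  obtain ⟨g, hl, hr⟩ := Function.bijective_iff_has_inverse.mp hf
  have key : ∀ j < p, ∀ k i, h (g^[j + 1] (x (k + j + 1) i)) = γ (fun i => h (x k i)) i := by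
    intro j
    induction j with
    | zero =>
      intro _ k i
      obtain ⟨w, ⟨_, hw⟩, e⟩ := hdyn k i
      simp only [add_zero, zero_add, Function.iterate_one]
      rw [← e, hl]
      exact hw
    | succ j ih =>
      intro hj k i
      obtain ⟨w, ⟨hw, _⟩, e⟩ := hdyn (k + j + 1) i
      rw [mem_plus_aux f g h hl hr] at hw
      rw [← ih (by omega) k i, ← hw j (by omega), Function.iterate_succ_apply,
        show k + (j + 1) + 1 = k + j + 1 + 1 by omega, ← e, hl]
  intro k hk σ hσ H
  obtain ⟨s, rfl⟩ : ∃ s, σ = s + 1 := ⟨σ - 1, by omega⟩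
  have canc : ∀ a b : ℕ, ∀ z, f^[a] (g^[a + b] z) = g^[b] z := by
    intro a b z
    rw [Function.iterate_add_apply]
    exact (Function.RightInverse.iterate hr a) _
  -- the outputs of the backward orbit
  have H' : ∀ j < p, IsDiag (γ^[s] fun i => h (g^[j + 1] (x k i))) := by
    intro j hj
    have h1 := H (j + 1) (by omega) (by omega)
    rw [Function.iterate_succ_apply] at h1
    have h2 : (fun i => h (g^[j + 1] (x k i))) = γ (fun i => h (x (k - (j + 1)) i)) := by
      funext i
      rw [← key j hj (k - (j + 1)) i, show k - (j + 1) + j + 1 = k by omega]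
    rw [h2]
    exact h1
  simp only [Nat.add_sub_cancel]
  rcases Nat.eq_zero_or_pos s with rfl | hs
  · simp only [Function.iterate_zero, id] at H' ⊢
    intro i j
    have hz : g (x k i) = g (x k j) := by
      obtain ⟨z, hz⟩ := hsing (g (x k j)) (h (g (x k j)))
      have m1 : g (x k i) ∈ obsSetPlus' f h (p - 1) (g (x k j)) ∩ h ⁻¹' {h (g (x k j))} := by
        refine ⟨(mem_plus_aux f g h hl hr _ _ _).2 fun a ha => ?_, H' 0 (by omega) i j⟩
        exact H' (a + 1) (by omega) i j
      have m2 : g (x k j) ∈ obsSetPlus' f h (p - 1) (g (x k j)) ∩ h ⁻¹' {h (g (x k j))} :=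
        ⟨(mem_plus_aux f g h hl hr _ _ _).2 fun a ha => rfl, rfl⟩
      rw [hz] at m1 m2
      exact m1.trans m2.symm
    show h (x k i) = h (x k j)
    rw [← hr (x k i), hz, hr]
  · have c := hcomp s hs (fun i => g^[p] (x k i)) (by
      intro a ha
      have h1 := H' (p - a - 1) (by omega)
      have e : ∀ i, f^[a] (g^[p] (x k i)) = g^[p - a - 1 + 1] (x k i) := by
        intro i
        rw [← canc a (p - a - 1 + 1), show a + (p - a - 1 + 1) = p by omega]
      simp only [e]
      exact h1)
    have e : ∀ i, f^[p] (g^[p] (x k i)) = x k i := fun i => canc p 0 _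
    simp only [e] at c
    exact c
end

section
/- Suppose f : X → X is bijective and there exists an integer p ≥ 1 such that [x̂]_{p−2}^+ ∩ h⁻¹(y) is a singleton for all x̂ ∈ X and y ∈ Y. Then for every x ∈ X, the singleton {x} equals the intersection ⋂_{α=1}^{p} f^{α−1}(h⁻¹(h(f^{1−α}(x)))), i.e., {x} = h⁻¹(h(x)) ∩ f(h⁻¹(h(f⁻¹(x)))) ∩ ⋯ ∩ f^{p−1}(h⁻¹(h(f^{1−p}(x)))). -/
theorem mem_obsSet_iff_aux {X Y : Type*} [Nonempty X] (f : X → X) (h : X → Y)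
    (hf : Function.Bijective f) (k : ℕ) : ∀ x w : X, w ∈ obsSet f h k x ↔
      ∀ i ≤ k, h ((Function.invFun f)^[i] w) = h ((Function.invFun f)^[i] x) := by
  have hl := Function.leftInverse_invFun hf.1
  have hr := Function.rightInverse_invFun hf.2
  induction k with
  | zero => intro x w; simp [obsSet]
  | succ k ih =>
    intro x w
    have key : w ∈ obsSet f h (k + 1) x ↔
        Function.invFun f w ∈ obsSet f h k (Function.invFun f x) ∧ h w = h x := by
      simp only [obsSet, Set.mem_inter_iff, Set.mem_image, Set.mem_iUnion, Set.mem_preimage,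
        Set.mem_singleton_iff]
      refine and_congr_left fun _ => ⟨?_, fun hw => ⟨_, ⟨_, hr x, hw⟩, hr w⟩⟩
      rintro ⟨a, ⟨z, rfl, ha⟩, rfl⟩
      rwa [hl a, hl z]
    rw [key, ih]
    constructor
    · rintro ⟨h1, h2⟩ i hi
      cases i with
      | zero => exact h2
      | succ i => exact h1 i (by omega)
    · intro H
      exact ⟨fun i hi => H (i + 1) (by omega), H 0 (by omega)⟩

/-- `{x} = h⁻¹(h x) ∩ f(h⁻¹(h(f⁻¹ x))) ∩ ⋯ ∩ f^{p-1}(h⁻¹(h(f^{1-p} x)))`. -/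
theorem singleton_eq_iInter {X Y : Type*} [Nonempty X] (f : X → X) (h : X → Y)
    (hf : Function.Bijective f) (p : ℕ) (hp : 1 ≤ p)
    (hsing : ∀ xh : X, ∀ y ∈ Set.range h,
      ∃ z, obsSetPlus' f h (p - 1) xh ∩ h ⁻¹' {y} = {z})
    (x : X) :
    {x} = ⋂ α ∈ Finset.Icc 1 p,
      f^[α - 1] '' (h ⁻¹' {h ((Function.invFun f)^[α - 1] x)}) := by
  have hl := Function.leftInverse_invFun hf.1
  have hr := Function.rightInverse_invFun hf.2
  obtain ⟨n, rfl⟩ : ∃ n, p = n + 1 := ⟨p - 1, by omega⟩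
  obtain ⟨z, hz⟩ := hsing x (h x) ⟨x, rfl⟩
  have e : obsSetPlus' f h (n + 1 - 1) x ∩ h ⁻¹' {h x} = obsSet f h n x := by
    cases n with
    | zero => simp [obsSetPlus', obsSet]
    | succ n => rfl
  rw [e] at hz
  have hx : x ∈ obsSet f h n x := (mem_obsSet_iff_aux f h hf n x x).2 fun _ _ => rfl
  have hxz : x = z := by rw [hz] at hx; exact hx
  rw [← hxz] at hz
  rw [← hz]
  ext w
  rw [mem_obsSet_iff_aux f h hf]
  simp only [Set.mem_iInter, Finset.mem_Icc, Set.mem_image, Set.mem_preimage,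
    Set.mem_singleton_iff]
  constructor
  · rintro H i ⟨_, hi⟩
    exact ⟨_, H (i - 1) (by omega), hr.iterate (i - 1) w⟩
  · intro H i hi
    obtain ⟨a, ha, rfl⟩ := H (i + 1) ⟨by omega, by omega⟩
    rw [Nat.add_sub_cancel] at ha ⊢
    rw [hl.iterate i a, ha]
end

section
/- Let [γ_ij] ∈ ℝ^{q×q} be a deadbeat coupling matrix. Then the map γ = (γ_1,…,γ_q) : ℝ^q → ℝ^q defined by γ_i(y_1,…,y_q) = (Σ_{j=1}^q γ_ij y_j³)^{1/3} (real cube root) is a deadbeat interconnection: γ maps Y_0 into Y_0, and there exists an integer r ≥ 1 such that γ^r(ℝ^q) ⊆ Y_0. -/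
open Matrix Kronecker Polynomial

/-- The real cube root. -/
noncomputable def cbrt (t : ℝ) : ℝ := Real.sign t * |t| ^ ((1 : ℝ) / 3)

/-- The nonlinear coupling `γᵢ(𝐲) = (∑ⱼ γᵢⱼ yⱼ³)^{1/3}` (real cube root). -/
noncomputable def cubicCoupling {q : ℕ} (G : Matrix (Fin q) (Fin q) ℝ)
    (y : Fin q → ℝ) : Fin q → ℝ :=
  fun i => cbrt (∑ j, G i j * y j ^ 3)

theorem cbrt_cube (t : ℝ) : cbrt t ^ 3 = t := by
  have h : (|t| ^ ((1 : ℝ) / 3)) ^ 3 = |t| := by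
    rw [← Real.rpow_natCast, ← Real.rpow_mul (abs_nonneg t)]
    norm_num
  unfold cbrt
  rw [mul_pow, h]
  rcases lt_trichotomy t 0 with h0 | h0 | h0
  · rw [Real.sign_of_neg h0, abs_of_neg h0]; ring
  · subst h0; simp
  · rw [Real.sign_of_pos h0, abs_of_pos h0]; ring

theorem iterate_cube {q : ℕ} (G : Matrix (Fin q) (Fin q) ℝ) (y : Fin q → ℝ) (r : ℕ) :
    (fun i => ((cubicCoupling G)^[r] y) i ^ 3) = (G ^ r) *ᵥ (fun i => y i ^ 3) := by
  induction r with
  | zero => simp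
  | succ n ih =>
    rw [Function.iterate_succ_apply', pow_succ', ← Matrix.mulVec_mulVec, ← ih]
    funext i
    simp only [cubicCoupling, cbrt_cube]
    rfl

theorem fixed_isDiag {q : ℕ} (G : Matrix (Fin q) (Fin q) ℝ) (hG : IsDeadbeatCoupling G)
    (w : Fin q → ℝ) (hw : G *ᵥ w = w) : IsDiag w := by
  intro i j
  have hone : G *ᵥ (fun _ => (1 : ℝ)) = fun _ => 1 := by
    funext k
    simpa [Matrix.mulVec, dotProduct] using hG.1 k
  have hm : G.toLin'.charpoly.rootMultiplicity 1 = 1 := by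
    have hX : (X - 1 : ℝ[X]) = X - C 1 := by simp
    rw [Matrix.charpoly_toLin', hG.2, Polynomial.rootMultiplicity_mul, hX,
      Polynomial.rootMultiplicity_X_sub_C_self, Polynomial.rootMultiplicity_eq_zero]
    · simp [Polynomial.IsRoot]
    · rw [hX]
      exact mul_ne_zero (pow_ne_zero _ X_ne_zero) (X_sub_C_ne_zero 1)
  have hf := LinearMap.finrank_maxGenEigenspace_eq G.toLin' 1
  rw [hm] at hf
  have mem : ∀ v : Fin q → ℝ, G *ᵥ v = v →
      v ∈ Module.End.maxGenEigenspace G.toLin' 1 := by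
    intro v hv
    rw [Module.End.mem_maxGenEigenspace]
    exact ⟨1, by simp [hv]⟩
  obtain ⟨c, hc⟩ := exists_smul_eq_of_finrank_eq_one hf
    (x := ⟨fun _ => 1, mem _ hone⟩) (by
      intro h
      have := congrFun (congrArg Subtype.val h) i
      simp at this) ⟨w, mem w hw⟩
  have hc' : ∀ k, c = w k := fun k => by
    simpa using congrFun (congrArg Subtype.val hc) k
  rw [← hc' i, ← hc' j]

/-- For a deadbeat coupling matrix `[γᵢⱼ]`, the map
`γᵢ(𝐲) = (∑ⱼ γᵢⱼ yⱼ³)^{1/3}` is a deadbeat interconnection. -/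
theorem cubic_deadbeat_interconnection {q : ℕ}
    (G : Matrix (Fin q) (Fin q) ℝ) (hG : IsDeadbeatCoupling G) :
    (∀ y : Fin q → ℝ, IsDiag y → IsDiag (cubicCoupling G y)) ∧
    ∃ r : ℕ, 1 ≤ r ∧ ∀ y : Fin q → ℝ, IsDiag ((cubicCoupling G)^[r] y) := by
  constructor
  · intro y hy i j
    have h : ∀ k, ∑ l, G k l * y l ^ 3 = y i ^ 3 := fun k => by
      rw [Finset.sum_congr rfl (fun l _ => by rw [hy l i]), ← Finset.sum_mul, hG.1 k, one_mul]
    simp only [cubicCoupling, h]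
  · refine ⟨q - 1 + 1, by omega, fun y i j => ?_⟩
    have hCH : G ^ (q - 1) * (G - 1) = 0 := by
      have := Matrix.aeval_self_charpoly G
      rw [hG.2] at this
      simpa using this
    have hfix : G * G ^ (q - 1 + 1) = G ^ (q - 1 + 1) := by
      have h1 : G ^ (q - 1) * G = G ^ (q - 1) := by
        rw [mul_sub, mul_one, sub_eq_zero] at hCH
        exact hCH
      rw [← pow_succ', pow_succ, pow_succ, h1, h1]
    have hd := fixed_isDiag G hG _ (show G *ᵥ ((G ^ (q - 1 + 1)) *ᵥ (fun i => y i ^ 3)) = _ by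
      rw [Matrix.mulVec_mulVec, hfix])
    rw [← iterate_cube] at hd
    exact (Odd.strictMono_pow (by decide : Odd 3)).injective (hd i j)
end
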